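/- Let $f_1,f_2,f_3,f_4$ be an orthonormal basis of $\mathbb{R}^4$. Then $\left\|\tfrac94 f_1\wedge f_3 - \tfrac{3\sqrt3}{4} f_1\wedge f_4 + \tfrac{3\sqrt3}{4} f_2\wedge f_3 + \tfrac94 f_2\wedge f_4\right\| \le \tfrac{3\sqrt3}{2} < 3$, where $\|\alpha\|=\sup\{|\det(\alpha\wedge\beta)|:\beta$ a unit simple 2-vector$\}$. -/

import Mathlib

open scoped BigOperators

/-- Dot product on `ℝ⁴`. -/
def dotp (x y : Fin 4 → ℝ) : ℝ := ∑ i, x i * y i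

/-- Wedge product of two vectors of `ℝ⁴`. -/
def wedge (x y : Fin 4 → ℝ) : Fin 4 → Fin 4 → ℝ := fun i j => x i * y j - x j * y i

/-- Coefficient of the 4-form `α ∧ β` relative to `e₁ ∧ e₂ ∧ e₃ ∧ e₄`. -/
def wdet (α β : Fin 4 → Fin 4 → ℝ) : ℝ :=
  α 0 1 * β 2 3 - α 0 2 * β 1 3 + α 0 3 * β 1 2 +
  α 2 3 * β 0 1 - α 1 3 * β 0 2 + α 1 2 * β 0 3

/-- `β` is a unit simple 2-vector. -/
def IsUnitSimple (β : Fin 4 → Fin 4 → ℝ) : Prop :=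
  ∃ y z : Fin 4 → ℝ, dotp y y = 1 ∧ dotp z z = 1 ∧ dotp y z = 0 ∧ β = wedge y z

/-- A family of vectors of `ℝ⁴` that is orthonormal for `dotp`. -/
def DotpOrthonormal (x : Fin 4 → Fin 4 → ℝ) : Prop :=
  ∀ i j, dotp (x i) (x j) = if i = j then 1 else 0

theorem DotpOrthonormal.mul_transpose {x : Fin 4 → Fin 4 → ℝ} (hx : DotpOrthonormal x) :
    Matrix.of x * (Matrix.of x).transpose = 1 := by
  ext i j
  simpa [Matrix.mul_apply, Matrix.one_apply, dotp] using hx i j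

theorem DotpOrthonormal.abs_det {x : Fin 4 → Fin 4 → ℝ} (hx : DotpOrthonormal x) :
    |(Matrix.of x).det| = 1 := by
  have h := congrArg Matrix.det hx.mul_transpose
  rw [Matrix.det_mul, Matrix.det_transpose, Matrix.det_one, ← sq] at h
  exact (abs_eq zero_le_one).mpr (sq_eq_one_iff.mp h)

/-- Expansion of a vector in an orthonormal family. -/
theorem DotpOrthonormal.eq_sum {x : Fin 4 → Fin 4 → ℝ} (hx : DotpOrthonormal x)
    (y : Fin 4 → ℝ) : y = fun k => ∑ i, dotp (x i) y * x i k := by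
  have h := mul_eq_one_comm.mp hx.mul_transpose
  have hy : y = (Matrix.of x).transpose.mulVec ((Matrix.of x).mulVec y) := by
    rw [Matrix.mulVec_mulVec, h, Matrix.one_mulVec]
  conv_lhs => rw [hy]
  ext k
  simp [Matrix.mulVec, dotProduct, dotp, mul_comm]

/-- Parseval's identity. -/
theorem DotpOrthonormal.sum_sq {x : Fin 4 → Fin 4 → ℝ} (hx : DotpOrthonormal x)
    (y : Fin 4 → ℝ) : ∑ i, dotp (x i) y ^ 2 = dotp y y := by
  have h : dotp y y = ∑ k, y k * ∑ i, dotp (x i) y * x i k :=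
    Finset.sum_congr rfl fun k _ => congrArg (y k * ·) (congrFun (hx.eq_sum y) k)
  rw [h]
  simp_rw [Finset.mul_sum]
  rw [Finset.sum_comm]
  refine Finset.sum_congr rfl fun i _ => ?_
  rw [sq]
  conv_lhs => rw [dotp.eq_1 (x i) y, Finset.mul_sum]
  exact Finset.sum_congr rfl fun k _ => by simp only [dotp]; ring

/-- In the coordinates of a family `x`, pairing with `x₀ ∧ x₁ + x₂ ∧ x₃` is a standard
symplectic form scaled by the determinant of the family. -/
theorem wdet_wedge_add_wedge (x : Fin 4 → Fin 4 → ℝ) (a b : Fin 4 → ℝ) :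
    wdet (wedge (x 0) (x 1) + wedge (x 2) (x 3))
      (wedge (fun k => ∑ i, a i * x i k) (fun k => ∑ i, b i * x i k)) =
    (Matrix.of x).det * (a 2 * b 3 - a 3 * b 2 + (a 0 * b 1 - a 1 * b 0)) := by
  simp [wdet, wedge, Fin.sum_univ_succ, Matrix.det_succ_row_zero, Fin.succAbove]
  ring

theorem DotpOrthonormal.abs_wdet_le_one {x : Fin 4 → Fin 4 → ℝ} (hx : DotpOrthonormal x)
    {β : Fin 4 → Fin 4 → ℝ} (hβ : IsUnitSimple β) :
    |wdet (wedge (x 0) (x 1) + wedge (x 2) (x 3)) β| ≤ 1 := by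
  obtain ⟨y, z, hy, hz, -, rfl⟩ := hβ
  have hy' := hx.sum_sq y
  have hz' := hx.sum_sq z
  rw [hx.eq_sum y, hx.eq_sum z, wdet_wedge_add_wedge, abs_mul, hx.abs_det, one_mul]
  rw [hy, Fin.sum_univ_four] at hy'
  rw [hz, Fin.sum_univ_four] at hz'
  generalize dotp (x 0) y = a0, dotp (x 1) y = a1, dotp (x 2) y = a2, dotp (x 3) y = a3,
    dotp (x 0) z = b0, dotp (x 1) z = b1, dotp (x 2) z = b2, dotp (x 3) z = b3 at *
  rw [abs_le]
  constructor
  · nlinarith [sq_nonneg (a2 + b3), sq_nonneg (a3 - b2), sq_nonneg (a0 + b1), sq_nonneg (a1 - b0)]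
  · nlinarith [sq_nonneg (a2 - b3), sq_nonneg (a3 + b2), sq_nonneg (a0 - b1), sq_nonneg (a1 + b0)]

theorem dotp_comm (x y : Fin 4 → ℝ) : dotp x y = dotp y x :=
  Finset.sum_congr rfl fun i _ => mul_comm (x i) (y i)

theorem dotp_comb_right (a b : ℝ) (u v w : Fin 4 → ℝ) :
    dotp u (a • v + b • w) = a * dotp u v + b * dotp u w := by
  simp only [dotp, Fin.sum_univ_four, Pi.add_apply, Pi.smul_apply, smul_eq_mul]
  ring

theorem dotp_comb_left (a b : ℝ) (u v w : Fin 4 → ℝ) :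
    dotp (a • v + b • w) u = a * dotp v u + b * dotp w u := by
  simp only [dotp_comm _ u, dotp_comb_right]

/-- Rotating the last two vectors of an orthonormal family, and reordering. -/
theorem DotpOrthonormal.rotate {f : Fin 4 → Fin 4 → ℝ} (hf : DotpOrthonormal f) {c s : ℝ}
    (hcs : c ^ 2 + s ^ 2 = 1) :
    DotpOrthonormal ![f 0, c • f 2 + (-s) • f 3, f 1, s • f 2 + c • f 3] := by
  intro i j
  fin_cases i <;> fin_cases j <;>
    simp [-neg_smul, dotp_comb_left, dotp_comb_right, hf _ _] <;> linarith

theorem stmt_7 (f : Fin 4 → Fin 4 → ℝ)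
    (hf : ∀ i j, dotp (f i) (f j) = if i = j then 1 else 0) :
    (∀ β : Fin 4 → Fin 4 → ℝ, IsUnitSimple β →
      |wdet ((9 / 4 : ℝ) • wedge (f 0) (f 2) - (3 * Real.sqrt 3 / 4) • wedge (f 0) (f 3) +
             (3 * Real.sqrt 3 / 4) • wedge (f 1) (f 2) + (9 / 4 : ℝ) • wedge (f 1) (f 3)) β|
        ≤ 3 * Real.sqrt 3 / 2) ∧
    3 * Real.sqrt 3 / 2 < 3 := by
  have h3 : Real.sqrt 3 ^ 2 = 3 := Real.sq_sqrt (by norm_num)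
  have hpos : 0 ≤ 3 * Real.sqrt 3 / 2 := by positivity
  refine ⟨fun β hβ => ?_, by nlinarith⟩
  have hrot : (Real.sqrt 3 / 2) ^ 2 + (1 / 2 : ℝ) ^ 2 = 1 := by rw [div_pow, h3]; norm_num
  have key := (DotpOrthonormal.rotate hf hrot).abs_wdet_le_one hβ
  have hfac : (9 / 4 : ℝ) • wedge (f 0) (f 2) - (3 * Real.sqrt 3 / 4) • wedge (f 0) (f 3) +
      (3 * Real.sqrt 3 / 4) • wedge (f 1) (f 2) + (9 / 4 : ℝ) • wedge (f 1) (f 3) =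
      (3 * Real.sqrt 3 / 2) •
        (wedge (f 0) ((Real.sqrt 3 / 2) • f 2 + (-(1 / 2 : ℝ)) • f 3) +
          wedge (f 1) ((1 / 2 : ℝ) • f 2 + (Real.sqrt 3 / 2) • f 3)) := by
    ext i j
    simp only [wedge, Pi.add_apply, Pi.sub_apply, Pi.smul_apply, smul_eq_mul]
    linear_combination (-(3 / 4 : ℝ) * (f 0 i * f 2 j - f 0 j * f 2 i + f 1 i * f 3 j
      - f 1 j * f 3 i)) * h3
  have hsmul : ∀ (r : ℝ) (α : Fin 4 → Fin 4 → ℝ), wdet (r • α) β = r * wdet α β := by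
    intro r α
    simp only [wdet, Pi.smul_apply, smul_eq_mul]
    ring
  rw [hfac, hsmul, abs_mul, abs_of_nonneg hpos]
  exact mul_le_of_le_one_right hpos key
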